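/- Let K be the transition matrix of an irreducible birth and death chain on {0,1,...,n} with transition rates p_i, q_i, r_i, stationary distribution π and spectral gap λ (the smallest non-zero eigenvalue of I − K). Set s(i) = E_0 τ̃_i + E_n τ̃_i and b(i)² = Var_0(τ̃_i) + Var_n(τ̃_i). Let M ∈ {0,1,...,n} satisfy π([0,M]) ≥ 1/2 and π([M,n]) ≥ 1/2. Then for 0 ≤ i ≤ j ≤ M, s(i) − s(j) = Σ_{ℓ=i}^{j−1} (1 − 2π([0,ℓ]))/(p_ℓ π(ℓ)) ≥ 0; and for all 0 ≤ i ≤ n, b(i) ≥ 1/λ ≥ (1/2)·max over 0 ≤ j ≤ M ≤ k ≤ n of max{ Σ_{ℓ=j}^{M−1} π([0,j])/(p_ℓ π(ℓ)), Σ_{ℓ=M+1}^{k} π([k,n])/(q_ℓ π(ℓ)) }. -/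

import Mathlib

open scoped BigOperators
open Filter Matrix Polynomial MeasureTheory

noncomputable section

/-- An irreducible birth and death chain on `{0,1,...,n}`, together with its
(unique) stationary distribution. -/
structure BDChain (n : ℕ) where
  K : Matrix (Fin (n + 1)) (Fin (n + 1)) ℝ
  pi : Fin (n + 1) → ℝ
  K_nonneg : ∀ i j, 0 ≤ K i j
  K_rowSum : ∀ i, ∑ j, K i j = 1
  K_tridiag : ∀ i j : Fin (n + 1), 1 < |(i : ℤ) - (j : ℤ)| → K i j = 0
  K_irred : ∀ i : ℕ, ∀ h : i < n,
    0 < K ⟨i, by omega⟩ ⟨i + 1, by omega⟩ ∧ 0 < K ⟨i + 1, by omega⟩ ⟨i, by omega⟩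
  pi_pos : ∀ i, 0 < pi i
  pi_sum : ∑ i, pi i = 1
  pi_stat : ∀ j, ∑ i, pi i * K i j = pi j

namespace BDChain

variable {n : ℕ}

/-- `π([0,M])` -/
def piLow (c : BDChain n) (M : Fin (n + 1)) : ℝ :=
  ∑ ℓ : Fin (n + 1), if ℓ ≤ M then c.pi ℓ else 0

/-- `π([M,n])` -/
def piHigh (c : BDChain n) (M : Fin (n + 1)) : ℝ :=
  ∑ ℓ : Fin (n + 1), if M ≤ ℓ then c.pi ℓ else 0

/-- `π([a,b])` -/
def piInt (c : BDChain n) (a b : Fin (n + 1)) : ℝ :=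
  ∑ ℓ : Fin (n + 1), if a ≤ ℓ ∧ ℓ ≤ b then c.pi ℓ else 0

/-- The substochastic matrix of the chain killed at state `i`. -/
def killed (c : BDChain n) (i : Fin (n + 1)) : Matrix (Fin (n + 1)) (Fin (n + 1)) ℝ :=
  Matrix.of fun x y => if x = i ∨ y = i then 0 else c.K x y

/-- `P_j(τ_i > m)`, where `τ_i` is the discrete-time hitting time of state `i`. -/
def hitSurv (c : BDChain n) (i j : Fin (n + 1)) (m : ℕ) : ℝ :=
  if j = i then 0 else ∑ y, (c.killed i ^ m) j y

/-- `P_j(τ̃_i > t)`, where `τ̃_i` is the continuous-time hitting time of state `i`. -/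
def hitSurvC (c : BDChain n) (i j : Fin (n + 1)) (t : ℝ) : ℝ :=
  ∑' m : ℕ, (Real.exp (-t) * t ^ m / m.factorial) * c.hitSurv i j m

/-- `E_j τ_i` -/
def hitMean (c : BDChain n) (i j : Fin (n + 1)) : ℝ :=
  ∑' m : ℕ, c.hitSurv i j m

/-- `Var_j τ_i` -/
def hitVar (c : BDChain n) (i j : Fin (n + 1)) : ℝ :=
  (∑' m : ℕ, (2 * (m : ℝ) + 1) * c.hitSurv i j m) - (c.hitMean i j) ^ 2

/-- `E_j τ̃_i` -/
def hitMeanC (c : BDChain n) (i j : Fin (n + 1)) : ℝ :=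
  ∫ t in Set.Ioi (0 : ℝ), c.hitSurvC i j t

/-- `Var_j τ̃_i` -/
def hitVarC (c : BDChain n) (i j : Fin (n + 1)) : ℝ :=
  (∫ t in Set.Ioi (0 : ℝ), 2 * t * c.hitSurvC i j t) - (c.hitMeanC i j) ^ 2

/-- The substochastic matrix of the chain killed at states `i` and `k`. -/
def killed2 (c : BDChain n) (i k : Fin (n + 1)) : Matrix (Fin (n + 1)) (Fin (n + 1)) ℝ :=
  Matrix.of fun x y => if x = i ∨ x = k ∨ y = i ∨ y = k then 0 else c.K x y

/-- `P_j(min{τ_i, τ_k} > m)` -/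
def hitSurv2 (c : BDChain n) (i k j : Fin (n + 1)) (m : ℕ) : ℝ :=
  if j = i ∨ j = k then 0 else ∑ y, (c.killed2 i k ^ m) j y

/-- `E_j min{τ_i, τ_k}` -/
def hitMean2 (c : BDChain n) (i k j : Fin (n + 1)) : ℝ :=
  ∑' m : ℕ, c.hitSurv2 i k j m

/-- `E_j min{τ̃_i, τ̃_k}` -/
def hitMean2C (c : BDChain n) (i k j : Fin (n + 1)) : ℝ :=
  ∫ t in Set.Ioi (0 : ℝ),
    ∑' m : ℕ, (Real.exp (-t) * t ^ m / m.factorial) * c.hitSurv2 i k j m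

/-- The continuous-time kernel `H_t(x,y) = e^{-t(I-K)}(x,y)`. -/
def Ht (c : BDChain n) (t : ℝ) (x y : Fin (n + 1)) : ℝ :=
  ∑' m : ℕ, (Real.exp (-t) * t ^ m / m.factorial) * (c.K ^ m) x y

/-- Discrete-time total variation distance from starting state `x` at time `m`. -/
def dTV (c : BDChain n) (x : Fin (n + 1)) (m : ℕ) : ℝ :=
  ⨆ A : Finset (Fin (n + 1)), (∑ y ∈ A, (c.K ^ m) x y - ∑ y ∈ A, c.pi y)

/-- Continuous-time total variation distance from starting state `x` at time `t`. -/
def dTVC (c : BDChain n) (x : Fin (n + 1)) (t : ℝ) : ℝ :=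
  ⨆ A : Finset (Fin (n + 1)), (∑ y ∈ A, c.Ht t x y - ∑ y ∈ A, c.pi y)

/-- Maximum (over starting states) discrete-time total variation distance. -/
def dTVMax (c : BDChain n) (m : ℕ) : ℝ := ⨆ x, c.dTV x m

/-- Maximum (over starting states) continuous-time total variation distance. -/
def dTVMaxC (c : BDChain n) (t : ℝ) : ℝ := ⨆ x, c.dTVC x t

/-- Discrete-time separation from starting state `x` at time `m`. -/
def sep (c : BDChain n) (x : Fin (n + 1)) (m : ℕ) : ℝ :=
  ⨆ y, (1 - (c.K ^ m) x y / c.pi y)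

/-- Continuous-time separation from starting state `x` at time `t`. -/
def sepC (c : BDChain n) (x : Fin (n + 1)) (t : ℝ) : ℝ :=
  ⨆ y, (1 - c.Ht t x y / c.pi y)

end BDChain

/-- Discrete-time `ε`-mixing time for a distance profile `d`. -/
def mixD (d : ℕ → ℝ) (ε : ℝ) : ℕ := sInf {m : ℕ | d m ≤ ε}

/-- Continuous-time `ε`-mixing time for a distance profile `d`. -/
def mixC (d : ℝ → ℝ) (ε : ℝ) : ℝ := sInf {t : ℝ | 0 ≤ t ∧ d t ≤ ε}

/-- The set of (real) eigenvalues of a square matrix. -/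
def eigSet {ι : Type*} [Fintype ι] (M : Matrix ι ι ℝ) : Set ℝ :=
  {x | ∃ v : ι → ℝ, v ≠ 0 ∧ M.mulVec v = x • v}

/-- `l` is the smallest non-zero eigenvalue of `M`. -/
def IsSmallestNonzeroEig {ι : Type*} [Fintype ι] (M : Matrix ι ι ℝ) (l : ℝ) : Prop :=
  l ∈ eigSet M ∧ l ≠ 0 ∧ ∀ x ∈ eigSet M, x ≠ 0 → l ≤ x

/-- `l` is the smallest eigenvalue of `M`. -/
def IsSmallestEig {ι : Type*} [Fintype ι] (M : Matrix ι ι ℝ) (l : ℝ) : Prop :=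
  l ∈ eigSet M ∧ ∀ x ∈ eigSet M, l ≤ x

/-- The principal submatrix of `I - K` indexed by the states `0, 1, ..., M-1`. -/
def BDChain.subIK {n : ℕ} (c : BDChain n) (M : Fin (n + 1)) :
    Matrix (Fin (M : ℕ)) (Fin (M : ℕ)) ℝ :=
  Matrix.of fun a b =>
    (1 - c.K) (Fin.castLE M.isLt.le a) (Fin.castLE M.isLt.le b)

/-- A family of chains, with `ε ↦ n ↦ T ε n` the mixing time profile, presents a cutoff
with cutoff time `t`. -/
def cutoffWith (T : ℝ → ℕ → ℝ) (t : ℕ → ℝ) : Prop :=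
  ∀ ε ∈ Set.Ioo (0 : ℝ) 1, Filter.Tendsto (fun n => T ε n / t n) Filter.atTop (nhds 1)

/-- A family of chains presents a cutoff. -/
def hasCutoff (T : ℝ → ℕ → ℝ) : Prop :=
  ∃ t : ℕ → ℝ, (∀ n, 0 < t n) ∧ cutoffWith T t

/-- A family of chains presents a `(t_n, b_n)` cutoff. -/
def cutoffWindow (T : ℝ → ℕ → ℝ) (t b : ℕ → ℝ) : Prop :=
  (∀ᶠ n in Filter.atTop, 0 < t n) ∧ (∀ᶠ n in Filter.atTop, 0 < b n) ∧
  Filter.Tendsto (fun n => b n / t n) Filter.atTop (nhds 0) ∧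
  ∀ ε ∈ Set.Ioo (0 : ℝ) 1, ∃ C : ℝ, ∀ᶠ n in Filter.atTop, |T ε n - t n| ≤ C * b n


theorem mulVec_pow_nonneg {ι : Type*} [Fintype ι] [DecidableEq ι] {T : Matrix ι ι ℝ}
    (hT : ∀ x y, 0 ≤ T x y) {f : ι → ℝ} (hf : 0 ≤ f) (m : ℕ) : 0 ≤ T ^ m *ᵥ f := by
  induction m with
  | zero => simpa using hf
  | succ m ih =>
    rw [pow_succ', ← mulVec_mulVec]
    exact fun x => Finset.sum_nonneg fun y _ => mul_nonneg (hT x y) (ih y)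

theorem mulVec_pow_mono {ι : Type*} [Fintype ι] [DecidableEq ι] {T : Matrix ι ι ℝ}
    (hT : ∀ x y, 0 ≤ T x y) {f g : ι → ℝ} (hfg : f ≤ g) (m : ℕ) : T ^ m *ᵥ f ≤ T ^ m *ᵥ g := by
  have := mulVec_pow_nonneg hT (sub_nonneg.2 hfg) m
  rw [mulVec_sub] at this
  exact sub_nonneg.1 this

/-- Neumann series: if `u` solves `(1 - T) u = χ` and `v` solves `(1 - T) v = u` for a nonnegative
matrix `T`, then `u = ∑ T ^ m χ` and `v = ∑ (m + 1) T ^ m χ`. -/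
theorem hasSum_mulVec_pow {ι : Type*} [Fintype ι] [DecidableEq ι] {T : Matrix ι ι ℝ}
    (hT : ∀ x y, 0 ≤ T x y) {χ u v : ι → ℝ} {C D : ℝ} (hχ : 0 ≤ χ) (hu0 : 0 ≤ u) (hv0 : 0 ≤ v)
    (hu : u - T *ᵥ u = χ) (hv : v - T *ᵥ v = u) (hC : 1 ≤ C) (huC : u ≤ C • χ) (hvD : v ≤ D • u)
    (x : ι) :
    HasSum (fun m : ℕ => (T ^ m *ᵥ χ) x) (u x) ∧
      HasSum (fun m : ℕ => ((m : ℝ) + 1) * (T ^ m *ᵥ χ) x) (v x) := by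
  have hstep : ∀ (f g : ι → ℝ), f - T *ᵥ f = g → ∀ (m : ℕ),
      (T ^ m *ᵥ g) x = (T ^ m *ᵥ f) x - (T ^ (m + 1) *ᵥ f) x := by
    intro f g h m
    rw [← h, mulVec_sub, mulVec_mulVec, ← pow_succ, Pi.sub_apply]
  have hρ0 : 0 ≤ 1 - C⁻¹ := sub_nonneg.2 (inv_le_one_of_one_le₀ hC)
  have hρ1 : 1 - C⁻¹ < 1 := by
    have : 0 < C⁻¹ := by positivity
    linarith
  have hdecay : ∀ m : ℕ, T ^ m *ᵥ u ≤ (1 - C⁻¹) ^ m • u := by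
    intro m
    induction m with
    | zero => simp
    | succ m ih =>
      have h1 : T *ᵥ u ≤ (1 - C⁻¹) • u := by
        intro y
        have h2 := congrFun hu y
        have h3 := huC y
        simp only [Pi.sub_apply, Pi.smul_apply, smul_eq_mul] at h2 h3 ⊢
        have h4 : C⁻¹ * u y ≤ χ y := by
          rw [inv_mul_le_iff₀ (by positivity)]
          exact h3
        linarith
      rw [pow_succ, ← mulVec_mulVec]
      refine (mulVec_pow_mono hT h1 m).trans ?_
      rw [mulVec_smul, pow_succ', mul_smul]
      exact smul_le_smul_of_nonneg_left ih hρ0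
  have hux : ∀ m : ℕ, (T ^ m *ᵥ u) x ≤ (1 - C⁻¹) ^ m * u x := fun m => hdecay m x
  have hvx : ∀ m : ℕ, (T ^ m *ᵥ v) x ≤ D * (T ^ m *ᵥ u) x := by
    intro m
    have := mulVec_pow_mono hT hvD m x
    rwa [mulVec_smul] at this
  have hgeo := tendsto_pow_atTop_nhds_zero_of_lt_one hρ0 hρ1
  have hu_lim : Tendsto (fun N : ℕ => (T ^ N *ᵥ u) x) atTop (nhds 0) := by
    refine squeeze_zero (fun m => mulVec_pow_nonneg hT hu0 m x) hux ?_
    simpa using hgeo.mul_const (u x)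
  have hNu_lim : Tendsto (fun N : ℕ => (N : ℝ) * (T ^ N *ᵥ u) x) atTop (nhds 0) := by
    refine squeeze_zero (fun m => mul_nonneg m.cast_nonneg (mulVec_pow_nonneg hT hu0 m x))
      (fun m => mul_le_mul_of_nonneg_left (hux m) m.cast_nonneg) ?_
    simpa [mul_assoc] using (tendsto_self_mul_const_pow_of_lt_one hρ0 hρ1).mul_const (u x)
  have hv_lim : Tendsto (fun N : ℕ => (T ^ N *ᵥ v) x) atTop (nhds 0) := by
    refine squeeze_zero (fun m => mulVec_pow_nonneg hT hv0 m x) hvx ?_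
    simpa using hu_lim.const_mul D
  constructor
  · rw [hasSum_iff_tendsto_nat_of_nonneg fun m => mulVec_pow_nonneg hT hχ m x]
    have h : ∀ N : ℕ, ∑ m ∈ Finset.range N, (T ^ m *ᵥ χ) x = u x - (T ^ N *ᵥ u) x := by
      intro N
      induction N with
      | zero => simp
      | succ N ih => rw [Finset.sum_range_succ, ih, hstep u χ hu]; ring
    simp_rw [h]
    simpa using hu_lim.const_sub (u x)
  · rw [hasSum_iff_tendsto_nat_of_nonneg fun m =>
      mul_nonneg (by positivity) (mulVec_pow_nonneg hT hχ m x)]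
    have h : ∀ N : ℕ, ∑ m ∈ Finset.range N, ((m : ℝ) + 1) * (T ^ m *ᵥ χ) x =
        v x - (T ^ N *ᵥ v) x - N * (T ^ N *ᵥ u) x := by
      intro N
      induction N with
      | zero => simp
      | succ N ih =>
        rw [Finset.sum_range_succ, ih, hstep u χ hu]
        have := hstep v u hv N
        push_cast
        linear_combination this
    simp_rw [h]
    simpa using (hv_lim.const_sub (v x)).sub hNu_lim

theorem integrableOn_exp_neg_mul_pow (m : ℕ) :
    IntegrableOn (fun t : ℝ => Real.exp (-t) * t ^ m) (Set.Ioi 0) := by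
  have := Real.GammaIntegral_convergent (s := m + 1) (by positivity)
  simpa using this

theorem integral_exp_neg_mul_pow (m : ℕ) :
    ∫ t in Set.Ioi (0 : ℝ), Real.exp (-t) * t ^ m = m.factorial := by
  have := Real.Gamma_eq_integral (s := m + 1) (by positivity)
  rw [Real.Gamma_nat_eq_factorial] at this
  simpa using this.symm

theorem integral_tsum_exp_neg_mul_pow {a : ℕ → ℝ} {e : ℕ → ℕ} {s : ℝ} (ha : ∀ m, 0 ≤ a m)
    (hs : HasSum (fun m => a m * (e m).factorial) s) :
    ∫ t in Set.Ioi (0 : ℝ), ∑' m, a m * (Real.exp (-t) * t ^ e m) = s := by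
  have hint : ∀ m, ∫ t in Set.Ioi (0 : ℝ), a m * (Real.exp (-t) * t ^ e m) =
      a m * (e m).factorial := fun m => by
    rw [integral_const_mul, integral_exp_neg_mul_pow]
  have hnorm : ∀ m, ∫ t in Set.Ioi (0 : ℝ), ‖a m * (Real.exp (-t) * t ^ e m)‖ =
      a m * (e m).factorial := fun m => by
    rw [← hint]
    refine setIntegral_congr_fun measurableSet_Ioi fun t ht => ?_
    rw [Set.mem_Ioi] at ht
    have := ha m
    exact Real.norm_of_nonneg (by positivity)
  have h := hasSum_integral_of_summable_integral_norm
    (F := fun m (t : ℝ) => a m * (Real.exp (-t) * t ^ e m)) (μ := volume.restrict (Set.Ioi 0))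
    (fun m => (integrableOn_exp_neg_mul_pow (e m)).const_mul (a m))
    (by simpa only [hnorm] using hs.summable)
  simp only [hint] at h
  exact h.unique hs

theorem integral_poisson_tsum {s : ℕ → ℝ} {a : ℝ} (hs0 : ∀ m, 0 ≤ s m) (hs : HasSum s a) :
    ∫ t in Set.Ioi (0 : ℝ), ∑' m : ℕ, (Real.exp (-t) * t ^ m / m.factorial) * s m = a := by
  rw [← integral_tsum_exp_neg_mul_pow (a := fun m => s m / m.factorial) (e := id) (s := a)
    (fun m => div_nonneg (hs0 m) (by positivity))]
  · refine setIntegral_congr_fun measurableSet_Ioi fun t _ => tsum_congr fun m => ?_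
    simp only [id]
    ring
  · convert hs using 1
    ext m
    simp only [id]
    field_simp

theorem integral_two_mul_poisson_tsum {s : ℕ → ℝ} {b : ℝ} (hs0 : ∀ m, 0 ≤ s m)
    (hs : HasSum (fun m : ℕ => ((m : ℝ) + 1) * s m) b) :
    ∫ t in Set.Ioi (0 : ℝ),
      2 * t * ∑' m : ℕ, (Real.exp (-t) * t ^ m / m.factorial) * s m = 2 * b := by
  rw [← integral_tsum_exp_neg_mul_pow (a := fun m => 2 * s m / m.factorial) (e := fun m => m + 1)
    (s := 2 * b) (fun m => div_nonneg (mul_nonneg two_pos.le (hs0 m)) (by positivity))]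
  · refine setIntegral_congr_fun measurableSet_Ioi fun t _ => ?_
    rw [← tsum_mul_left]
    exact tsum_congr fun m => by ring
  · have h : ∀ m : ℕ, 2 * s m / m.factorial * (m + 1).factorial = 2 * (((m : ℝ) + 1) * s m) := by
      intro m
      rw [Nat.factorial_succ]
      push_cast
      field_simp
    simpa only [h] using hs.mul_left 2

namespace BDChain

variable {n : ℕ}

/-- The stationary flow `π(x) K(x,y)`, extended by zero to all natural numbers. -/
def flow (c : BDChain n) (x y : ℕ) : ℝ :=
  if h : x < n + 1 ∧ y < n + 1 then c.pi ⟨x, h.1⟩ * c.K ⟨x, h.1⟩ ⟨y, h.2⟩ else 0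

theorem flow_val (c : BDChain n) (x y : Fin (n + 1)) : c.flow x y = c.pi x * c.K x y := by
  rw [flow, dif_pos ⟨x.isLt, y.isLt⟩]

theorem flow_eq_zero (c : BDChain n) {x y : ℕ} (h1 : x ≠ y) (h2 : y ≠ x + 1) (h3 : x ≠ y + 1) :
    c.flow x y = 0 := by
  unfold flow
  split_ifs with h
  · rw [c.K_tridiag _ _ (by simp only [lt_abs]; omega), mul_zero]
  · rfl

theorem sum_range_neighbors {f : ℕ → ℝ} {k : ℕ} (hk : k < n) (hn : f (n + 1) = 0)
    (hf : ∀ y, y ≠ k → y ≠ k + 2 → f y = 0) :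
    ∑ y ∈ Finset.range (n + 1), f y = f (k + 2) + f k := by
  have h : ∑ y ∈ Finset.range (n + 2), f y = ∑ y ∈ Finset.range (n + 1), f y := by
    rw [Finset.sum_range_succ _ (n + 1), hn, add_zero]
  rw [← h, ← Finset.sum_subset (s₁ := {k, k + 2}), Finset.sum_pair (by omega), add_comm]
  · intro y hy
    simp only [Finset.mem_insert, Finset.mem_singleton] at hy
    rw [Finset.mem_range]
    omega
  · intro y _ hy
    simp only [Finset.mem_insert, Finset.mem_singleton, not_or] at hy
    exact hf y hy.1 hy.2

theorem sum_range_neighbors_zero {f : ℕ → ℝ} (hn : f (n + 1) = 0) (hf : ∀ y, y ≠ 1 → f y = 0) :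
    ∑ y ∈ Finset.range (n + 1), f y = f 1 := by
  refine Finset.sum_eq_single 1 (fun y _ hy => hf y hy) fun h => ?_
  rw [Finset.mem_range] at h
  rwa [show (1 : ℕ) = n + 1 by omega]

theorem sum_flow_sub_flow (c : BDChain n) {x : ℕ} (hx : x < n + 1) :
    ∑ y ∈ Finset.range (n + 1), (c.flow y x - c.flow x y) = 0 := by
  rw [← Fin.sum_univ_eq_sum_range (fun y => c.flow y x - c.flow x y) (n + 1)]
  have h1 := c.pi_stat ⟨x, hx⟩
  have h2 := c.K_rowSum ⟨x, hx⟩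
  have h3 : ∀ y : Fin (n + 1), c.flow y x - c.flow x y =
      c.pi y * c.K y ⟨x, hx⟩ - c.pi ⟨x, hx⟩ * c.K ⟨x, hx⟩ y := fun y => by
    rw [← c.flow_val, ← c.flow_val]
  simp only [h3]
  rw [Finset.sum_sub_distrib, h1, ← Finset.mul_sum, h2, mul_one, sub_self]

theorem flow_succ_left (c : BDChain n) (m : ℕ) : c.flow (m + 1) m = c.flow m (m + 1) := by
  have hout : ∀ x, c.flow (n + 1) x - c.flow x (n + 1) = 0 := fun x => by simp [flow]
  induction m with
  | zero =>
    have h := c.sum_flow_sub_flow (x := 0) (by omega)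
    rw [sum_range_neighbors_zero (f := fun y => c.flow y 0 - c.flow 0 y) (hout 0)] at h
    · exact sub_eq_zero.1 h
    · intro y hy
      rcases Nat.eq_zero_or_pos y with rfl | h0
      · exact sub_self _
      · rw [c.flow_eq_zero, c.flow_eq_zero, sub_zero] <;> omega
  | succ k ih =>
    by_cases hk : k < n
    · have h := c.sum_flow_sub_flow (x := k + 1) (by omega)
      rw [sum_range_neighbors (f := fun y => c.flow y (k + 1) - c.flow (k + 1) y) hk
        (hout (k + 1))] at h
      · linarith
      · intro y hy hy'
        rcases eq_or_ne y (k + 1) with rfl | h0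
        · exact sub_self _
        · rw [c.flow_eq_zero, c.flow_eq_zero, sub_zero] <;> omega
    · rw [flow, flow, dif_neg (by omega), dif_neg (by omega)]

theorem flow_comm (c : BDChain n) (x y : ℕ) : c.flow x y = c.flow y x := by
  by_cases h1 : x = y
  · rw [h1]
  by_cases h2 : y = x + 1
  · rw [h2, c.flow_succ_left]
  by_cases h3 : x = y + 1
  · rw [h3, c.flow_succ_left]
  rw [c.flow_eq_zero h1 h2 h3, c.flow_eq_zero (Ne.symm h1) h3 h2]

theorem detailed_balance (c : BDChain n) (x y : Fin (n + 1)) :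
    c.pi x * c.K x y = c.pi y * c.K y x := by
  rw [← c.flow_val, ← c.flow_val, c.flow_comm]

theorem flow_succ_nonneg (c : BDChain n) (m : ℕ) : 0 ≤ c.flow m (m + 1) := by
  unfold flow
  split_ifs with h
  · exact mul_nonneg (c.pi_pos _).le (c.K_nonneg _ _)
  · rfl

theorem flow_succ_pos (c : BDChain n) {m : ℕ} (hm : m < n) : 0 < c.flow m (m + 1) := by
  rw [flow, dif_pos (by omega)]
  exact mul_pos (c.pi_pos _) (c.K_irred m hm).1

/-- `(I - K) f`. -/
def lap (c : BDChain n) (f : Fin (n + 1) → ℝ) (x : Fin (n + 1)) : ℝ :=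
  f x - ∑ y, c.K x y * f y

theorem one_sub_mulVec (c : BDChain n) (f : Fin (n + 1) → ℝ) : (1 - c.K) *ᵥ f = c.lap f := by
  ext x
  rw [sub_mulVec, one_mulVec, Pi.sub_apply, lap, mulVec, dotProduct]

theorem pi_mul_lap (c : BDChain n) (F : ℕ → ℝ) (x : Fin (n + 1)) :
    c.pi x * c.lap (fun y => F y) x =
      ∑ y ∈ Finset.range (n + 1), c.flow x y * (F x - F y) := by
  rw [← Fin.sum_univ_eq_sum_range (fun y => c.flow x y * (F x - F y)) (n + 1)]
  simp only [flow_val, mul_sub, Finset.sum_sub_distrib, lap, mul_assoc, ← Finset.mul_sum]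
  rw [← Finset.sum_mul, c.K_rowSum, one_mul]

theorem pi_mul_lap_zero (c : BDChain n) (F : ℕ → ℝ) {x : Fin (n + 1)} (hx : (x : ℕ) = 0) :
    c.pi x * c.lap (fun y => F y) x = c.flow 0 1 * (F 0 - F 1) := by
  rw [pi_mul_lap, hx, sum_range_neighbors_zero (f := fun y => c.flow 0 y * (F 0 - F y))]
  · simp [flow]
  · intro y hy
    rcases Nat.eq_zero_or_pos y with rfl | h0
    · simp
    · rw [c.flow_eq_zero, zero_mul] <;> omega

theorem pi_mul_lap_succ (c : BDChain n) (F : ℕ → ℝ) {x : Fin (n + 1)} {k : ℕ}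
    (hx : (x : ℕ) = k + 1) :
    c.pi x * c.lap (fun y => F y) x = c.flow (k + 1) (k + 2) * (F (k + 1) - F (k + 2)) -
      c.flow k (k + 1) * (F k - F (k + 1)) := by
  rw [pi_mul_lap, hx,
    sum_range_neighbors (f := fun y => c.flow (k + 1) y * (F (k + 1) - F y)) (k := k) (by omega)]
  · rw [c.flow_succ_left]
    ring
  · simp [flow]
  · intro y hy hy'
    rcases eq_or_ne y (k + 1) with rfl | h0
    · simp
    · rw [c.flow_eq_zero, zero_mul] <;> omega

theorem lap_sub_const (c : BDChain n) (f : Fin (n + 1) → ℝ) (a : ℝ) :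
    c.lap (fun y => f y - a) = c.lap f := by
  ext x
  simp only [lap, mul_sub, Finset.sum_sub_distrib, ← Finset.sum_mul, c.K_rowSum]
  ring

theorem sum_pi_mul_lap_comm (c : BDChain n) (f g : Fin (n + 1) → ℝ) :
    ∑ x, c.pi x * g x * c.lap f x = ∑ x, c.pi x * f x * c.lap g x := by
  simp only [lap, mul_sub, Finset.sum_sub_distrib, Finset.mul_sum]
  rw [Finset.sum_comm (f := fun x y => c.pi x * g x * (c.K x y * f y))]
  congr 1
  · exact Finset.sum_congr rfl fun x _ => by ring
  · refine Finset.sum_congr rfl fun x _ => Finset.sum_congr rfl fun y _ => ?_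
    linear_combination f x * g y * c.detailed_balance y x

theorem sum_pi_mul_lap (c : BDChain n) (f : Fin (n + 1) → ℝ) : ∑ x, c.pi x * c.lap f x = 0 := by
  have h := c.sum_pi_mul_lap_comm f (fun _ => 1)
  simpa [lap, c.K_rowSum] using h

theorem sum_pi_mul_mul_lap_self_nonneg (c : BDChain n) (f : Fin (n + 1) → ℝ) :
    0 ≤ ∑ x, c.pi x * f x * c.lap f x := by
  have h1 : ∑ x, ∑ y, c.pi x * c.K x y * f x ^ 2 = ∑ x, c.pi x * f x ^ 2 :=
    Finset.sum_congr rfl fun x _ => by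
      rw [← Finset.sum_mul, ← Finset.mul_sum, c.K_rowSum, mul_one]
  have h2 : ∑ x, ∑ y, c.pi x * c.K x y * f y ^ 2 = ∑ x, c.pi x * f x ^ 2 := by
    rw [Finset.sum_comm]
    exact Finset.sum_congr rfl fun y _ => by rw [← Finset.sum_mul, c.pi_stat]
  have h3 : ∑ x, c.pi x * f x * c.lap f x =
      ∑ x, c.pi x * f x ^ 2 - ∑ x, ∑ y, c.pi x * c.K x y * (f x * f y) := by
    rw [← Finset.sum_sub_distrib]
    refine Finset.sum_congr rfl fun x _ => ?_
    rw [lap, mul_sub, Finset.mul_sum]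
    congr 1
    · ring
    · exact Finset.sum_congr rfl fun y _ => by ring
  have h4 : 0 ≤ ∑ x, ∑ y, c.pi x * c.K x y * (f x - f y) ^ 2 :=
    Finset.sum_nonneg fun x _ => Finset.sum_nonneg fun y _ =>
      mul_nonneg (mul_nonneg (c.pi_pos x).le (c.K_nonneg x y)) (sq_nonneg _)
  have h5 : ∑ x, ∑ y, c.pi x * c.K x y * (f x - f y) ^ 2 =
      ∑ x, ∑ y, c.pi x * c.K x y * f x ^ 2 + ∑ x, ∑ y, c.pi x * c.K x y * f y ^ 2 -
        2 * ∑ x, ∑ y, c.pi x * c.K x y * (f x * f y) := by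
    simp only [Finset.mul_sum, ← Finset.sum_add_distrib, ← Finset.sum_sub_distrib]
    exact Finset.sum_congr rfl fun x _ => Finset.sum_congr rfl fun y _ => by ring
  linarith

/-- The resistance between `0` and `m` in the associated electrical network. -/
def potential (c : BDChain n) (m : ℕ) : ℝ := ∑ l ∈ Finset.range m, (c.flow l (l + 1))⁻¹

theorem potential_succ (c : BDChain n) (m : ℕ) :
    c.potential (m + 1) = c.potential m + (c.flow m (m + 1))⁻¹ := Finset.sum_range_succ _ _

theorem potential_mono (c : BDChain n) : Monotone c.potential :=
  monotone_nat_of_le_succ fun m => by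
    rw [c.potential_succ, le_add_iff_nonneg_right]
    exact inv_nonneg.2 (c.flow_succ_nonneg m)

/-- The Green function of the chain killed at `i`, with respect to `π`. -/
def green (c : BDChain n) (i x y : ℕ) : ℝ :=
  min (max (c.potential i - c.potential x) 0) (max (c.potential i - c.potential y) 0) +
    min (max (c.potential x - c.potential i) 0) (max (c.potential y - c.potential i) 0)

theorem green_comm (c : BDChain n) (i x y : ℕ) : c.green i x y = c.green i y x := by
  rw [green, green, min_comm, min_comm (max (c.potential x - _) 0)]

theorem green_nonneg (c : BDChain n) (i x y : ℕ) : 0 ≤ c.green i x y := by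
  unfold green
  positivity

theorem green_self_left (c : BDChain n) (i y : ℕ) : c.green i i y = 0 := by
  simp [green]

theorem green_of_le_of_le (c : BDChain n) {i x y : ℕ} (hx : x ≤ i) (hy : y ≤ i) :
    c.green i x y = min (c.potential i - c.potential x) (c.potential i - c.potential y) := by
  have h1 := c.potential_mono hx
  have h2 := c.potential_mono hy
  rw [green, max_eq_left (by linarith), max_eq_left (by linarith), max_eq_right (by linarith),
    max_eq_right (by linarith), min_self, add_zero]

theorem green_of_ge_of_ge (c : BDChain n) {i x y : ℕ} (hx : i ≤ x) (hy : i ≤ y) :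
    c.green i x y = min (c.potential x - c.potential i) (c.potential y - c.potential i) := by
  have h1 := c.potential_mono hx
  have h2 := c.potential_mono hy
  rw [green, max_eq_right (by linarith), max_eq_right (by linarith), max_eq_left (by linarith),
    max_eq_left (by linarith), min_self, zero_add]

theorem green_of_le_of_ge (c : BDChain n) {i x y : ℕ} (hx : x ≤ i) (hy : i ≤ y) :
    c.green i x y = 0 := by
  have h1 := c.potential_mono hx
  have h2 := c.potential_mono hy
  rw [green, max_eq_left (by linarith), max_eq_right (by linarith), max_eq_right (by linarith),
    max_eq_left (by linarith), min_eq_right (by linarith), min_eq_left (by linarith), add_zero]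

theorem flow_mul_green_sub (c : BDChain n) {i m y : ℕ} (hi : i ≤ n) (hy : y ≤ n) :
    c.flow m (m + 1) * (c.green i m y - c.green i (m + 1) y) =
      (if y ≤ m ∧ m < i then 1 else 0) - (if i ≤ m ∧ m < y then 1 else 0) := by
  by_cases hm : m < n
  · have hpos := c.flow_succ_pos hm
    have hs := c.potential_succ m
    have hinv : c.flow m (m + 1) * (c.flow m (m + 1))⁻¹ = 1 := mul_inv_cancel₀ hpos.ne'
    rcases lt_or_ge m i with hmi | hmi <;> rcases le_total y i with hyi | hyi <;>
      rcases lt_or_ge m y with hmy | hmy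
    · rw [c.green_of_le_of_le hmi.le hyi, c.green_of_le_of_le hmi hyi,
        min_eq_right (by linarith [c.potential_mono hmy.le]),
        min_eq_right (by linarith [c.potential_mono (show m + 1 ≤ y from hmy)]),
        if_neg (by omega), if_neg (by omega)]
      ring
    · rw [c.green_of_le_of_le hmi.le hyi, c.green_of_le_of_le hmi hyi,
        min_eq_left (by linarith [c.potential_mono hmy]),
        min_eq_left (by linarith [c.potential_mono (show y ≤ m + 1 by omega)]),
        if_pos (by omega), if_neg (by omega), hs]
      linear_combination hinv
    · rw [c.green_of_le_of_ge hmi.le hyi, c.green_of_le_of_ge hmi hyi, if_neg (by omega),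
        if_neg (by omega)]
      ring
    · omega
    · omega
    · rw [c.green_comm, c.green_comm i (m + 1), c.green_of_le_of_ge hyi hmi,
        c.green_of_le_of_ge hyi (by omega), if_neg (by omega), if_neg (by omega)]
      ring
    · rw [c.green_of_ge_of_ge hmi hyi, c.green_of_ge_of_ge (by omega) hyi,
        min_eq_left (by linarith [c.potential_mono hmy.le]),
        min_eq_left (by linarith [c.potential_mono (show m + 1 ≤ y from hmy)]),
        if_neg (by omega), if_pos (by omega), hs]
      linear_combination -hinv
    · rw [c.green_of_ge_of_ge hmi hyi, c.green_of_ge_of_ge (by omega) hyi,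
        min_eq_right (by linarith [c.potential_mono hmy]),
        min_eq_right (by linarith [c.potential_mono (show y ≤ m + 1 by omega)]),
        if_neg (by omega), if_neg (by omega)]
      ring
  · rw [flow, dif_neg (by omega), if_neg (by omega), if_neg (by omega)]
    ring

theorem pi_mul_lap_green (c : BDChain n) {i x : Fin (n + 1)} (y : Fin (n + 1)) (hx : x ≠ i) :
    c.pi x * c.lap (fun z => c.green i z y) x = if x = y then 1 else 0 := by
  have hi : (i : ℕ) ≤ n := by omega
  have hy : (y : ℕ) ≤ n := by omega
  have hxi : (x : ℕ) ≠ i := fun h => hx (Fin.ext h)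
  rw [if_congr (Fin.ext_iff (a := x) (b := y)) rfl rfl]
  obtain h | ⟨k, hk⟩ : (x : ℕ) = 0 ∨ ∃ k, (x : ℕ) = k + 1 := by
    rcases h : (x : ℕ) with _ | k
    · exact .inl rfl
    · exact .inr ⟨k, rfl⟩
  · rw [c.pi_mul_lap_zero (fun z => c.green i z y) h, c.flow_mul_green_sub hi hy]
    split_ifs <;> first | omega | norm_num
  · rw [c.pi_mul_lap_succ (fun z => c.green i z y) hk, c.flow_mul_green_sub hi hy,
      c.flow_mul_green_sub hi hy]
    split_ifs <;> first | omega | norm_num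

theorem sum_green_mul_lap (c : BDChain n) (i x : Fin (n + 1)) (f : Fin (n + 1) → ℝ) :
    ∑ y : Fin (n + 1), c.green i x y * (c.pi y * c.lap f y) = f x - f i := by
  have h := c.sum_pi_mul_lap_comm (fun y => f y - f i) (fun y => c.green i y x)
  rw [c.lap_sub_const] at h
  calc _ = ∑ y, c.pi y * c.green i y x * c.lap f y :=
        Finset.sum_congr rfl fun y _ => by rw [c.green_comm]; ring
    _ = ∑ y, (if y = x then f y - f i else 0) := by
        rw [h]
        refine Finset.sum_congr rfl fun y _ => ?_
        by_cases hy : y = i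
        · simp [hy]
        · rw [mul_right_comm, c.pi_mul_lap_green x hy]
          split_ifs <;> ring
    _ = _ := by simp

theorem eq_of_lap_eq_zero (c : BDChain n) {f : Fin (n + 1) → ℝ} (hf : c.lap f = 0)
    (x y : Fin (n + 1)) : f x = f y := by
  have h := c.sum_green_mul_lap y x f
  simp only [hf, Pi.zero_apply, mul_zero, Finset.sum_const_zero] at h
  linarith

/-- The Green operator of the chain killed at `i`. -/
def greenOp (c : BDChain n) (i : Fin (n + 1)) (h : Fin (n + 1) → ℝ) (x : Fin (n + 1)) : ℝ :=
  ∑ y : Fin (n + 1), c.green i x y * (c.pi y * h y)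

theorem greenOp_self (c : BDChain n) (i : Fin (n + 1)) (h : Fin (n + 1) → ℝ) :
    c.greenOp i h i = 0 := by
  simp [greenOp, green_self_left]

theorem greenOp_mono (c : BDChain n) (i : Fin (n + 1)) {f g : Fin (n + 1) → ℝ} (h : f ≤ g) :
    c.greenOp i f ≤ c.greenOp i g := fun _ =>
  Finset.sum_le_sum fun y _ => mul_le_mul_of_nonneg_left
    (mul_le_mul_of_nonneg_left (h y) (c.pi_pos y).le) (c.green_nonneg _ _ _)

theorem greenOp_nonneg (c : BDChain n) (i : Fin (n + 1)) {f : Fin (n + 1) → ℝ} (h : 0 ≤ f) :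
    0 ≤ c.greenOp i f := fun _ =>
  Finset.sum_nonneg fun y _ => mul_nonneg (c.green_nonneg _ _ _)
    (mul_nonneg (c.pi_pos y).le (h y))

theorem greenOp_smul (c : BDChain n) (i : Fin (n + 1)) (a : ℝ) (f : Fin (n + 1) → ℝ) :
    c.greenOp i (a • f) = a • c.greenOp i f := by
  ext x
  simp only [greenOp, Pi.smul_apply, smul_eq_mul, Finset.mul_sum]
  exact Finset.sum_congr rfl fun y _ => by ring

theorem lap_greenOp (c : BDChain n) {i x : Fin (n + 1)} (h : Fin (n + 1) → ℝ) (hx : x ≠ i) :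
    c.lap (c.greenOp i h) x = h x := by
  have h1 : c.lap (c.greenOp i h) x =
      ∑ y : Fin (n + 1), c.lap (fun z => c.green i z y) x * (c.pi y * h y) := by
    simp only [lap, greenOp, sub_mul, Finset.sum_sub_distrib, Finset.mul_sum, Finset.sum_mul]
    rw [Finset.sum_comm]
    simp only [mul_assoc]
  have h2 : ∀ y : Fin (n + 1), c.lap (fun z => c.green i z y) x * (c.pi y * h y) =
      if x = y then h y else 0 := fun y => by
    have h3 := c.pi_mul_lap_green y hx
    have h4 := c.pi_pos x
    split_ifs at h3 ⊢ with h5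
    · subst h5
      linear_combination h x * h3
    · rw [(mul_eq_zero.1 h3).resolve_left h4.ne', zero_mul]
  rw [h1, Finset.sum_congr rfl fun y _ => h2 y]
  simp

theorem killed_nonneg (c : BDChain n) (i x y : Fin (n + 1)) : 0 ≤ c.killed i x y := by
  simp only [killed, of_apply]
  split_ifs
  · rfl
  · exact c.K_nonneg x y

theorem greenOp_sub_killed_mulVec (c : BDChain n) (i : Fin (n + 1)) {h : Fin (n + 1) → ℝ}
    (hi : h i = 0) : c.greenOp i h - c.killed i *ᵥ c.greenOp i h = h := by
  ext x
  simp only [Pi.sub_apply, mulVec, dotProduct, killed, of_apply]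
  by_cases hx : x = i
  · simp [hx, hi, greenOp_self]
  · rw [← c.lap_greenOp h hx, lap]
    congr 1
    refine Finset.sum_congr rfl fun y _ => ?_
    by_cases hy : y = i
    · simp [hy, greenOp_self]
    · simp [hx, hy]

theorem greenOp_off_self (c : BDChain n) (i : Fin (n + 1)) (h : Fin (n + 1) → ℝ) :
    c.greenOp i (fun y => if y = i then 0 else h y) = c.greenOp i h := by
  ext x
  refine Finset.sum_congr rfl fun y _ => ?_
  dsimp only
  split_ifs with hy
  · rw [hy, c.green_comm, c.green_self_left]
    ring
  · rfl

theorem hitSurv_eq (c : BDChain n) (i j : Fin (n + 1)) (m : ℕ) :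
    c.hitSurv i j m = (c.killed i ^ m *ᵥ fun y => if y = i then 0 else 1) j := by
  by_cases hj : j = i
  · rw [hitSurv, if_pos hj, hj]
    cases m with
    | zero => simp
    | succ m =>
      rw [pow_succ', ← mulVec_mulVec]
      simp [mulVec, dotProduct, killed]
  · rw [hitSurv, if_neg hj]
    cases m with
    | zero => simp [one_apply, hj]
    | succ m =>
      have h : (c.killed i *ᵥ fun y => if y = i then 0 else 1) = c.killed i *ᵥ 1 := by
        ext x
        simp only [mulVec, dotProduct]
        refine Finset.sum_congr rfl fun y _ => ?_
        by_cases hy : y = i <;> simp [hy, killed]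
      rw [pow_succ, ← mulVec_mulVec, h, mulVec_mulVec]
      simp [mulVec, dotProduct]

theorem hasSum_hitSurv (c : BDChain n) (i j : Fin (n + 1)) :
    HasSum (c.hitSurv i j) (c.greenOp i 1 j) ∧
      HasSum (fun m : ℕ => ((m : ℝ) + 1) * c.hitSurv i j m) (c.greenOp i (c.greenOp i 1) j) := by
  set χ : Fin (n + 1) → ℝ := fun y => if y = i then 0 else 1 with hχ
  have hu : c.greenOp i χ = c.greenOp i 1 := c.greenOp_off_self i 1
  have hu0 : 0 ≤ c.greenOp i 1 := c.greenOp_nonneg i zero_le_one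
  have hC : c.greenOp i 1 ≤ (1 + ∑ y, c.greenOp i 1 y) • χ := by
    intro x
    by_cases hx : x = i
    · simp [hχ, hx, greenOp_self]
    · have := Finset.single_le_sum (fun y _ => hu0 y) (Finset.mem_univ x)
      simp only [hχ, Pi.smul_apply, hx, if_false, smul_eq_mul, mul_one]
      linarith
  have key := hasSum_mulVec_pow (T := c.killed i) (χ := χ) (c.killed_nonneg i)
    (fun x => by simp only [hχ]; split_ifs <;> simp) hu0 (c.greenOp_nonneg i hu0)
    (by rw [← hu]; exact c.greenOp_sub_killed_mulVec i (by simp [hχ]))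
    (c.greenOp_sub_killed_mulVec i (c.greenOp_self i 1))
    (le_add_of_nonneg_right (Finset.sum_nonneg fun y _ => hu0 y)) hC
    (by
      have := c.greenOp_mono i hC
      rwa [greenOp_smul, hu] at this) j
  rw [show c.hitSurv i j = fun m => (c.killed i ^ m *ᵥ χ) j from funext (c.hitSurv_eq i j)]
  exact key

theorem hitSurv_nonneg (c : BDChain n) (i j : Fin (n + 1)) (m : ℕ) : 0 ≤ c.hitSurv i j m := by
  rw [hitSurv_eq]
  exact mulVec_pow_nonneg (c.killed_nonneg i) (fun x => by dsimp only; split_ifs <;> simp) m j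

theorem hitMeanC_eq (c : BDChain n) (i j : Fin (n + 1)) :
    c.hitMeanC i j = c.greenOp i 1 j :=
  integral_poisson_tsum (c.hitSurv_nonneg i j) (c.hasSum_hitSurv i j).1

theorem hitVarC_eq (c : BDChain n) (i j : Fin (n + 1)) :
    c.hitVarC i j = 2 * c.greenOp i (c.greenOp i 1) j - c.greenOp i 1 j ^ 2 := by
  rw [hitVarC, hitMeanC_eq]
  congr 1
  exact integral_two_mul_poisson_tsum (c.hitSurv_nonneg i j) (c.hasSum_hitSurv i j).2

theorem green_zero_left (c : BDChain n) (i : ℕ) (y : Fin (n + 1)) :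
    c.green i ((0 : Fin (n + 1)) : ℕ) y = max (c.potential i - c.potential y) 0 := by
  have h1 := c.potential_mono (Nat.zero_le i)
  have h2 := c.potential_mono (Nat.zero_le y)
  rw [green, Fin.val_zero, max_eq_right (show c.potential 0 - c.potential i ≤ 0 by linarith),
    min_eq_left (le_max_right _ _), add_zero,
    min_eq_right (max_le_max_right 0 (by linarith))]

theorem green_last_left (c : BDChain n) (i y : Fin (n + 1)) :
    c.green i (Fin.last n) y = max (c.potential y - c.potential i) 0 := by
  have h1 := c.potential_mono (show (i : ℕ) ≤ n by omega)
  have h2 := c.potential_mono (show (y : ℕ) ≤ n by omega)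
  rw [green, Fin.val_last, max_eq_right (show c.potential i - c.potential n ≤ 0 by linarith),
    min_eq_left (le_max_right _ _), zero_add,
    min_eq_right (max_le_max_right 0 (by linarith))]

theorem hitMeanC_zero_add_hitMeanC_last (c : BDChain n) (i : Fin (n + 1)) :
    c.hitMeanC i 0 + c.hitMeanC i (Fin.last n) =
      ∑ y : Fin (n + 1), c.pi y * |c.potential i - c.potential y| := by
  simp only [hitMeanC_eq, greenOp, green_zero_left, green_last_left, Pi.one_apply, mul_one]
  rw [← Finset.sum_add_distrib]
  refine Finset.sum_congr rfl fun y _ => ?_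
  rcases le_total (c.potential i) (c.potential y) with h | h
  · rw [max_eq_right (by linarith), max_eq_left (by linarith), abs_of_nonpos (by linarith)]
    ring
  · rw [max_eq_left (by linarith), max_eq_right (by linarith), abs_of_nonneg (by linarith)]
    ring

theorem green_sq (c : BDChain n) (i x y : ℕ) :
    (max (c.potential i - c.potential x) 0 + max (c.potential i - c.potential y) 0 +
        (max (c.potential x - c.potential i) 0 + max (c.potential y - c.potential i) 0)) *
          c.green i x y -
      max (c.potential i - c.potential x) 0 * max (c.potential i - c.potential y) 0 -
      max (c.potential x - c.potential i) 0 * max (c.potential y - c.potential i) 0 =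
    c.green i x y ^ 2 := by
  unfold green
  generalize c.potential i = a
  generalize c.potential x = b
  generalize c.potential y = d
  rcases le_total a b with h1 | h1 <;> rcases le_total a d with h2 | h2 <;>
    simp only [h1, h2, sub_nonneg, sub_nonpos, max_eq_left, max_eq_right, min_self]
  · rcases le_total b d with h3 | h3
    · rw [min_eq_left (by linarith)]; ring
    · rw [min_eq_right (by linarith)]; ring
  · rw [min_eq_left (by linarith), min_eq_right (by linarith)]; ring
  · rw [min_eq_right (by linarith), min_eq_left (by linarith)]; ring
  · rcases le_total b d with h3 | h3
    · rw [min_eq_right (by linarith)]; ring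
    · rw [min_eq_left (by linarith)]; ring

/-- The sum of the two variances is the squared Hilbert-Schmidt norm of the Green operator. -/
theorem hitVarC_zero_add_hitVarC_last (c : BDChain n) (i : Fin (n + 1)) :
    c.hitVarC i 0 + c.hitVarC i (Fin.last n) =
      ∑ x : Fin (n + 1), ∑ y : Fin (n + 1), c.pi x * c.pi y * c.green i x y ^ 2 := by
  have hvar : ∀ a : Fin (n + 1) → ℝ,
      2 * ∑ x : Fin (n + 1), a x * (c.pi x * c.greenOp i 1 x) - (∑ x, a x * c.pi x) ^ 2 =
        ∑ x : Fin (n + 1), ∑ y : Fin (n + 1),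
          c.pi x * c.pi y * ((a x + a y) * c.green i x y - a x * a y) := by
    intro a
    have h1 : ∑ x : Fin (n + 1), a x * (c.pi x * c.greenOp i 1 x) =
        ∑ x : Fin (n + 1), ∑ y : Fin (n + 1), c.pi x * c.pi y * (a x * c.green i x y) := by
      refine Finset.sum_congr rfl fun x _ => ?_
      simp only [greenOp, Finset.mul_sum, Pi.one_apply]
      exact Finset.sum_congr rfl fun y _ => by ring
    have h2 : ∑ x : Fin (n + 1), a x * (c.pi x * c.greenOp i 1 x) =
        ∑ x : Fin (n + 1), ∑ y : Fin (n + 1), c.pi x * c.pi y * (a y * c.green i x y) := by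
      rw [h1, Finset.sum_comm]
      refine Finset.sum_congr rfl fun x _ => Finset.sum_congr rfl fun y _ => ?_
      rw [c.green_comm]
      ring
    rw [two_mul]
    nth_rewrite 1 [h1]
    rw [h2, sq, Finset.sum_mul_sum, ← Finset.sum_add_distrib, ← Finset.sum_sub_distrib]
    refine Finset.sum_congr rfl fun x _ => ?_
    rw [← Finset.sum_add_distrib, ← Finset.sum_sub_distrib]
    exact Finset.sum_congr rfl fun y _ => by ring
  have h0 := hvar fun x => max (c.potential i - c.potential x) 0
  have hn := hvar fun x => max (c.potential x - c.potential i) 0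
  rw [hitVarC_eq, hitVarC_eq, greenOp, greenOp, greenOp, greenOp]
  simp only [green_zero_left, green_last_left, Pi.one_apply, mul_one]
  rw [h0, hn, ← Finset.sum_add_distrib]
  refine Finset.sum_congr rfl fun x _ => ?_
  rw [← Finset.sum_add_distrib]
  refine Finset.sum_congr rfl fun y _ => ?_
  rw [← c.green_sq]
  ring

theorem one_div_le_sqrt_hitVarC (c : BDChain n) {lam : ℝ} (hlam : lam ∈ eigSet (1 - c.K))
    (h0 : lam ≠ 0) (i : Fin (n + 1)) :
    1 / lam ≤ Real.sqrt (c.hitVarC i 0 + c.hitVarC i (Fin.last n)) := by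
  obtain ⟨f, hf, hlf⟩ := hlam
  rw [one_sub_mulVec] at hlf
  have hmean : ∑ x, c.pi x * f x = 0 := by
    have h := c.sum_pi_mul_lap f
    simp only [hlf, Pi.smul_apply, smul_eq_mul, mul_left_comm _ lam, ← Finset.mul_sum] at h
    exact (mul_eq_zero.1 h).resolve_left h0
  have hpos : 0 < ∑ x, c.pi x * f x ^ 2 := by
    obtain ⟨x, hx⟩ := Function.ne_iff.1 hf
    exact Finset.sum_pos' (fun y _ => mul_nonneg (c.pi_pos y).le (sq_nonneg _))
      ⟨x, Finset.mem_univ x, mul_pos (c.pi_pos x) (sq_pos_of_ne_zero hx)⟩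
  have hrep : ∀ x, f x - f i = lam * ∑ y : Fin (n + 1), c.green i x y * (c.pi y * f y) := by
    intro x
    rw [← c.sum_green_mul_lap, hlf, Finset.mul_sum]
    exact Finset.sum_congr rfl fun y _ => by simp only [Pi.smul_apply, smul_eq_mul]; ring
  have hshift : ∑ x, c.pi x * (f x - f i) ^ 2 = ∑ x, c.pi x * f x ^ 2 + f i ^ 2 := by
    have : ∀ x, c.pi x * (f x - f i) ^ 2 =
        c.pi x * f x ^ 2 - 2 * f i * (c.pi x * f x) + f i ^ 2 * c.pi x := fun x => by ring
    simp only [this, Finset.sum_add_distrib, Finset.sum_sub_distrib, ← Finset.mul_sum, hmean,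
      c.pi_sum]
    ring
  have hcs : ∀ x : Fin (n + 1), (∑ y : Fin (n + 1), c.green i x y * (c.pi y * f y)) ^ 2 ≤
      (∑ y : Fin (n + 1), c.pi y * c.green i x y ^ 2) * ∑ y, c.pi y * f y ^ 2 := by
    intro x
    have h := Finset.sum_mul_sq_le_sq_mul_sq Finset.univ
      (fun y : Fin (n + 1) => Real.sqrt (c.pi y) * c.green i x y)
      (fun y => Real.sqrt (c.pi y) * f y)
    simp only [mul_pow, Real.sq_sqrt (c.pi_pos _).le] at h
    refine le_trans (le_of_eq ?_) h
    congr 1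
    refine Finset.sum_congr rfl fun y _ => ?_
    linear_combination -(c.green i x y * f y) * Real.mul_self_sqrt (c.pi_pos y).le
  have hle : ∑ x, c.pi x * f x ^ 2 ≤ lam ^ 2 *
      (c.hitVarC i 0 + c.hitVarC i (Fin.last n)) * ∑ x, c.pi x * f x ^ 2 := by
    calc _ ≤ ∑ x, c.pi x * (f x - f i) ^ 2 := by rw [hshift]; linarith [sq_nonneg (f i)]
      _ ≤ ∑ x : Fin (n + 1), c.pi x * (lam ^ 2 *
          ((∑ y : Fin (n + 1), c.pi y * c.green i x y ^ 2) * ∑ y, c.pi y * f y ^ 2)) := by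
          refine Finset.sum_le_sum fun x _ => mul_le_mul_of_nonneg_left ?_ (c.pi_pos x).le
          rw [hrep, mul_pow]
          exact mul_le_mul_of_nonneg_left (hcs x) (sq_nonneg lam)
      _ = _ := by
          generalize ∑ x, c.pi x * f x ^ 2 = s
          rw [c.hitVarC_zero_add_hitVarC_last, Finset.mul_sum, Finset.sum_mul]
          refine Finset.sum_congr rfl fun x _ => ?_
          simp only [mul_assoc, ← Finset.mul_sum]
          ring
  have hb : 1 ≤ lam ^ 2 * (c.hitVarC i 0 + c.hitVarC i (Fin.last n)) :=
    le_of_mul_le_mul_right (by rwa [one_mul]) hpos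
  refine Real.le_sqrt_of_sq_le ?_
  rw [div_pow, one_pow, div_le_iff₀ (by positivity)]
  linarith

theorem pos_of_mem_eigSet (c : BDChain n) {lam : ℝ} (hlam : lam ∈ eigSet (1 - c.K))
    (h0 : lam ≠ 0) : 0 < lam := by
  obtain ⟨f, hf, hlf⟩ := hlam
  rw [one_sub_mulVec] at hlf
  have hpos : 0 < ∑ x, c.pi x * f x ^ 2 := by
    obtain ⟨x, hx⟩ := Function.ne_iff.1 hf
    exact Finset.sum_pos' (fun y _ => mul_nonneg (c.pi_pos y).le (sq_nonneg _))
      ⟨x, Finset.mem_univ x, mul_pos (c.pi_pos x) (sq_pos_of_ne_zero hx)⟩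
  have h := c.sum_pi_mul_mul_lap_self_nonneg f
  have h1 : ∑ x, c.pi x * f x * c.lap f x = lam * ∑ x, c.pi x * f x ^ 2 := by
    rw [hlf, Finset.mul_sum]
    exact Finset.sum_congr rfl fun x _ => by simp only [Pi.smul_apply, smul_eq_mul]; ring
  rw [h1] at h
  exact (nonneg_of_mul_nonneg_left h hpos).lt_of_ne' h0

/-- The Poincaré inequality for the spectral gap. -/
theorem poincare (c : BDChain n) {lam : ℝ} (hlam : IsSmallestNonzeroEig (1 - c.K) lam)
    (f : Fin (n + 1) → ℝ) :
    lam * (∑ x, c.pi x * f x ^ 2 - (∑ x, c.pi x * f x) ^ 2) ≤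
      ∑ x, c.pi x * f x * c.lap f x := by
  set w : Fin (n + 1) → ℝ := fun x => Real.sqrt (c.pi x) with hw
  have hwpos : ∀ x, 0 < w x := fun x => Real.sqrt_pos.2 (c.pi_pos x)
  have hww : ∀ x, w x * w x = c.pi x := fun x => Real.mul_self_sqrt (c.pi_pos x).le
  set B : Matrix (Fin (n + 1)) (Fin (n + 1)) ℝ :=
    Matrix.of fun x y => w x * ((if x = y then 1 - lam else 0) - c.K x y) / w y + lam * (w x * w y)
    with hB
  have hBmul : ∀ g : Fin (n + 1) → ℝ, ∀ x, (B *ᵥ fun y => w y * g y) x =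
      w x * (c.lap g x - lam * g x + lam * ∑ y, c.pi y * g y) := by
    intro g x
    have h1 : ∀ y, B x y * (w y * g y) =
        w x * ((if x = y then (1 - lam) * g y else 0) - c.K x y * g y +
          lam * (c.pi y * g y)) := fun y => by
      have := (hwpos y).ne'
      rw [hB, of_apply, ← hww y]
      split_ifs <;> field_simp <;> ring
    simp only [mulVec, dotProduct, h1]
    rw [← Finset.mul_sum, Finset.sum_add_distrib, Finset.sum_sub_distrib, ← Finset.mul_sum, lap]
    simp only [Finset.sum_ite_eq, Finset.mem_univ, if_true]
    ring
  have hherm : B.IsHermitian := by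
    refine IsHermitian.ext fun x y => ?_
    have hx := (hwpos x).ne'
    have hy := (hwpos y).ne'
    have hxy := c.detailed_balance x y
    rw [← hww, ← hww] at hxy
    rw [star_trivial, hB, of_apply, of_apply]
    by_cases h : x = y
    · rw [h]
    · rw [if_neg h, if_neg (Ne.symm h)]
      field_simp
      linear_combination hxy
  have hpsd : B.PosSemidef := by
    rw [hherm.posSemidef_iff_eigenvalues_nonneg]
    intro k
    set μ := hherm.eigenvalues k with hμ
    have hv := hherm.mulVec_eigenvectorBasis k
    have hv0 : (⇑(hherm.eigenvectorBasis k) : Fin (n + 1) → ℝ) ≠ 0 := fun h => by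
      have h1 := hherm.eigenvectorBasis.orthonormal.ne_zero k
      exact h1 (by ext x; exact congrFun h x)
    rw [← hμ] at hv
    generalize (⇑(hherm.eigenvectorBasis k) : Fin (n + 1) → ℝ) = v at hv hv0
    obtain ⟨g, rfl⟩ : ∃ g : Fin (n + 1) → ℝ, v = fun y => w y * g y :=
      ⟨fun y => v y / w y, funext fun y => by have := (hwpos y).ne'; field_simp⟩
    have hg0 : g ≠ 0 := by
      rintro rfl
      exact hv0 (by ext; simp)
    have hg : ∀ x, c.lap g x - lam * g x + lam * ∑ y, c.pi y * g y = μ * g x := fun x => by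
      have h := congrFun hv x
      rw [hBmul, Pi.smul_apply, smul_eq_mul, mul_left_comm] at h
      exact mul_left_cancel₀ (hwpos x).ne' h
    set m := ∑ y, c.pi y * g y with hm
    have hμm : μ * m = 0 := by
      have h1 : ∑ x, c.pi x * (c.lap g x - lam * g x + lam * m) = ∑ x, c.pi x * (μ * g x) :=
        Finset.sum_congr rfl fun x _ => by rw [hg]
      have h2 : ∑ x, c.pi x * (c.lap g x - lam * g x + lam * m) =
          ∑ x, c.pi x * c.lap g x - lam * m + lam * m * ∑ x, c.pi x := by
        have h4 : ∀ x, c.pi x * (c.lap g x - lam * g x + lam * m) =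
            c.pi x * c.lap g x - lam * (c.pi x * g x) + lam * m * c.pi x := fun x => by ring
        simp only [h4, Finset.sum_add_distrib, Finset.sum_sub_distrib, ← Finset.mul_sum, ← hm]
      have h3 : ∑ x, c.pi x * (μ * g x) = μ * m := by
        rw [hm, Finset.mul_sum]
        exact Finset.sum_congr rfl fun x _ => by ring
      rw [h2, h3, c.sum_pi_mul_lap, c.pi_sum] at h1
      linarith
    change 0 ≤ μ
    rcases mul_eq_zero.1 hμm with h | hm0
    · exact h.ge
    · have hlg : c.lap g = (μ + lam) • g := by
        ext x
        have := hg x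
        rw [hm0] at this
        simp only [Pi.smul_apply, smul_eq_mul]
        linarith
      have hne : μ + lam ≠ 0 := by
        intro h
        rw [h, zero_smul] at hlg
        have hconst := c.eq_of_lap_eq_zero hlg
        refine hg0 (funext fun x => ?_)
        have : m = g x := by
          rw [hm, Finset.sum_congr rfl fun y _ => by rw [hconst y x], ← Finset.sum_mul, c.pi_sum,
            one_mul]
        rw [← this, hm0, Pi.zero_apply]
      have := hlam.2.2 (μ + lam) ⟨g, hg0, by rw [one_sub_mulVec, hlg]⟩ hne
      linarith
  have h := hpsd.dotProduct_mulVec_nonneg (fun y => w y * f y)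
  have h1 : star (fun y => w y * f y) ⬝ᵥ (B *ᵥ fun y => w y * f y) =
      ∑ x, c.pi x * f x * c.lap f x - lam * ∑ x, c.pi x * f x ^ 2 +
        lam * (∑ x, c.pi x * f x) ^ 2 := by
    have h2 : ∀ x, w x * f x * (B *ᵥ fun y => w y * f y) x =
        c.pi x * f x * c.lap f x - lam * (c.pi x * f x ^ 2) +
          lam * (∑ y, c.pi y * f y) * (c.pi x * f x) := fun x => by
      rw [hBmul]
      linear_combination (f x * (c.lap f x - lam * f x + lam * ∑ y, c.pi y * f y)) * hww x
    simp only [star_trivial, dotProduct, h2, Finset.sum_add_distrib, Finset.sum_sub_distrib,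
      ← Finset.mul_sum]
    ring
  rw [h1] at h
  linarith

theorem sum_pi_mul_green_mul_lap (c : BDChain n) (i j : Fin (n + 1)) :
    ∑ x : Fin (n + 1), c.pi x * c.green i j x * c.lap (fun z => c.green i j z) x =
      c.green i j j := by
  have h := c.sum_green_mul_lap i j fun z => c.green i j z
  rw [c.green_comm i j i, c.green_self_left, sub_zero] at h
  rw [← h]
  exact Finset.sum_congr rfl fun x _ => by ring

/-- If `green i j` is supported on a set of mass at most `1/2` and attains its maximum on `A`, then
half the mass of `A` times the maximum is at most the relaxation time. -/
theorem half_mul_mass_mul_green_le (c : BDChain n) {lam : ℝ}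
    (hlam : IsSmallestNonzeroEig (1 - c.K) lam) {i j : Fin (n + 1)} {A S : Finset (Fin (n + 1))}
    (hA : ∀ x ∈ A, c.green i j x = c.green i j j) (hS : ∀ x ∉ S, c.green i j x = 0)
    (hmass : ∑ x ∈ S, c.pi x ≤ 1 / 2) :
    1 / 2 * ((∑ x ∈ A, c.pi x) * c.green i j j) ≤ 1 / lam := by
  have hpos := c.pos_of_mem_eigSet hlam.1 hlam.2.1
  have hP := c.poincare hlam fun z => c.green i j z
  rw [sum_pi_mul_green_mul_lap] at hP
  set g : Fin (n + 1) → ℝ := fun x => c.green i j x with hg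
  set E := ∑ x, c.pi x * g x ^ 2 with hE
  have hsupp : ∑ x, c.pi x * g x = ∑ x ∈ S, c.pi x * g x :=
    (Finset.sum_subset (Finset.subset_univ S) fun x _ hx => by rw [hg]; simp [hS x hx]).symm
  have hES : ∑ x ∈ S, c.pi x * g x ^ 2 ≤ E :=
    Finset.sum_le_sum_of_subset_of_nonneg (Finset.subset_univ S) fun x _ _ =>
      mul_nonneg (c.pi_pos x).le (sq_nonneg _)
  have hE0 : 0 ≤ E := Finset.sum_nonneg fun x _ => mul_nonneg (c.pi_pos x).le (sq_nonneg _)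
  have hcs : (∑ x, c.pi x * g x) ^ 2 ≤ 1 / 2 * E := by
    have h := Finset.sum_mul_sq_le_sq_mul_sq S (fun x => Real.sqrt (c.pi x))
      (fun x => Real.sqrt (c.pi x) * g x)
    simp only [mul_pow, Real.sq_sqrt (c.pi_pos _).le, ← mul_assoc,
      Real.mul_self_sqrt (c.pi_pos _).le] at h
    rw [hsupp]
    exact h.trans (mul_le_mul hmass hES (Finset.sum_nonneg fun x _ =>
      mul_nonneg (c.pi_pos x).le (sq_nonneg _)) (by norm_num))
  have hEA : (∑ x ∈ A, c.pi x) * c.green i j j ^ 2 ≤ E := by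
    refine le_trans (le_of_eq ?_) (Finset.sum_le_sum_of_subset_of_nonneg (Finset.subset_univ A)
      fun x _ _ => mul_nonneg (c.pi_pos x).le (sq_nonneg _))
    rw [Finset.sum_mul]
    exact Finset.sum_congr rfl fun x hx => by rw [hg]; simp only [hA x hx]
  rcases (c.green_nonneg i j j).eq_or_lt with h0 | h0
  · rw [← h0]
    simpa using hpos.le
  · rw [le_div_iff₀ hpos]
    refine le_of_mul_le_mul_right ?_ h0
    have h1 : lam * (1 / 2 * ((∑ x ∈ A, c.pi x) * c.green i j j ^ 2)) ≤
        lam * (E - (∑ x, c.pi x * g x) ^ 2) :=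
      mul_le_mul_of_nonneg_left (by linarith) hpos.le
    linarith

theorem val_add_one_of_lt (x : Fin (n + 1)) (hx : (x : ℕ) < n) :
    x + 1 = ⟨x + 1, by omega⟩ := by
  ext
  rw [Fin.val_add_one_of_lt (by rw [Fin.lt_def]; simpa using hx)]

theorem val_sub_one_of_pos {x : Fin (n + 1)} (hx : 0 < (x : ℕ)) :
    x - 1 = ⟨x - 1, by omega⟩ := by
  ext
  rw [Fin.val_sub_one_of_ne_zero (fun h => by simp [h] at hx)]

theorem sum_ite_eq_sub_of_succ {F : ℕ → ℝ} {t : Fin (n + 1) → ℝ} {i j : Fin (n + 1)} (hij : i ≤ j)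
    (ht : ∀ l : Fin (n + 1), (l : ℕ) < n → t l = F (l + 1) - F l) :
    ∑ l, (if i ≤ l ∧ l < j then t l else 0) = F j - F i := by
  have h1 : ∀ l : Fin (n + 1), (if i ≤ l ∧ l < j then t l else 0) =
      if (l : ℕ) ∈ Finset.Ico (i : ℕ) j then F (l + 1) - F l else 0 := fun l => by
    simp only [Finset.mem_Ico, Fin.le_def, Fin.lt_def]
    split_ifs with h
    · exact ht l (by omega)
    · rfl
  simp only [h1]
  rw [Fin.sum_univ_eq_sum_range (fun l => if l ∈ Finset.Ico (i : ℕ) j then F (l + 1) - F l else 0),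
    Finset.sum_ite_mem, Finset.inter_eq_right.2, Finset.sum_Ico_sub F hij]
  intro l hl
  rw [Finset.mem_Ico] at hl
  rw [Finset.mem_range]
  omega

theorem sum_ite_eq_sub_of_pred {F : ℕ → ℝ} {t : Fin (n + 1) → ℝ} {i j : Fin (n + 1)} (hij : i ≤ j)
    (ht : ∀ l : Fin (n + 1), 0 < (l : ℕ) → t l = F l - F (l - 1)) :
    ∑ l, (if i < l ∧ l ≤ j then t l else 0) = F j - F i := by
  rw [← sum_ite_eq_sub_of_succ (n := n) (t := fun l => F (l + 1) - F l) hij fun _ _ => rfl,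
    Fin.sum_univ_succ, Fin.sum_univ_castSucc, add_comm]
  congr 1
  · refine Finset.sum_congr rfl fun l _ => ?_
    rw [ht _ (by simp)]
    simp only [Fin.lt_def, Fin.le_def, Fin.val_succ, Fin.val_castSucc, Nat.lt_succ_iff,
      Nat.succ_le_iff, Nat.add_sub_cancel]
  · rw [if_neg (by simp), if_neg (fun h => absurd h.2 (not_lt.2 (Fin.le_last j)))]

theorem inv_K_mul_pi_eq (c : BDChain n) (l : Fin (n + 1)) (hl : (l : ℕ) < n) :
    (c.K l (l + 1) * c.pi l)⁻¹ = c.potential (l + 1) - c.potential l := by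
  rw [c.potential_succ, add_sub_cancel_left, val_add_one_of_lt l hl, mul_comm, ← c.flow_val]

theorem inv_K_sub_one_mul_pi_eq (c : BDChain n) (l : Fin (n + 1)) (hl : 0 < (l : ℕ)) :
    (c.K l (l - 1) * c.pi l)⁻¹ = c.potential l - c.potential (l - 1) := by
  have h := c.potential_succ (l - 1)
  rw [Nat.sub_add_cancel hl] at h
  rw [h, add_sub_cancel_left, val_sub_one_of_pos hl, mul_comm, ← c.flow_val, c.flow_comm]

theorem piLow_eq (c : BDChain n) (M : Fin (n + 1)) :
    c.piLow M = ∑ x ∈ Finset.univ.filter (· ≤ M), c.pi x := (Finset.sum_filter _ _).symm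

theorem piHigh_eq (c : BDChain n) (M : Fin (n + 1)) :
    c.piHigh M = ∑ x ∈ Finset.univ.filter (M ≤ ·), c.pi x := (Finset.sum_filter _ _).symm

theorem sum_lt_eq (c : BDChain n) (M : Fin (n + 1)) :
    ∑ x ∈ Finset.univ.filter (· < M), c.pi x = 1 - c.piHigh M := by
  have h := Finset.sum_filter_add_sum_filter_not Finset.univ (· < M) c.pi
  simp only [not_lt] at h
  rw [c.piHigh_eq, ← c.pi_sum, ← h, add_sub_cancel_right]

theorem sum_gt_eq (c : BDChain n) (M : Fin (n + 1)) :
    ∑ x ∈ Finset.univ.filter (M < ·), c.pi x = 1 - c.piLow M := by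
  have h := Finset.sum_filter_add_sum_filter_not Finset.univ (M < ·) c.pi
  simp only [not_lt] at h
  rw [c.piLow_eq, ← c.pi_sum, ← h, add_sub_cancel_right]

theorem piLow_le_half (c : BDChain n) {M : Fin (n + 1)} (hM : 1 / 2 ≤ c.piHigh M)
    {l : Fin (n + 1)} (hl : l < M) : c.piLow l ≤ 1 / 2 := by
  have h : c.piLow l ≤ ∑ x ∈ Finset.univ.filter (· < M), c.pi x := by
    rw [c.piLow_eq]
    refine Finset.sum_le_sum_of_subset_of_nonneg (fun x hx => ?_) fun x _ _ => (c.pi_pos x).le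
    simp only [Finset.mem_filter, Finset.mem_univ, true_and] at hx ⊢
    exact hx.trans_lt hl
  rw [c.sum_lt_eq] at h
  linarith

theorem sum_abs_potential_sub_succ (c : BDChain n) (l : Fin (n + 1)) :
    ∑ y : Fin (n + 1), c.pi y * |c.potential l - c.potential y| -
        ∑ y : Fin (n + 1), c.pi y * |c.potential (l + 1) - c.potential y| =
      (1 - 2 * c.piLow l) * (c.potential (l + 1) - c.potential l) := by
  have h1 : ∀ y : Fin (n + 1), c.pi y * |c.potential l - c.potential y| -
      c.pi y * |c.potential (l + 1) - c.potential y| =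
        (c.pi y - 2 * if y ≤ l then c.pi y else 0) *
          (c.potential (l + 1) - c.potential l) := fun y => by
    have hm := c.potential_mono (Nat.le_succ l)
    split_ifs with h
    · have h2 := c.potential_mono (Fin.le_def.1 h)
      rw [abs_of_nonneg (by linarith), abs_of_nonneg (by linarith)]
      ring
    · have h2 := c.potential_mono (Nat.succ_le_iff.2 (Fin.lt_def.1 (not_le.1 h)))
      rw [abs_of_nonpos (by linarith), abs_of_nonpos (by linarith)]
      ring
  rw [← Finset.sum_sub_distrib, Finset.sum_congr rfl fun y _ => h1 y, ← Finset.sum_mul,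
    Finset.sum_sub_distrib, c.pi_sum, ← Finset.mul_sum, piLow]

theorem hitMeanC_sub_eq (c : BDChain n) {i j : Fin (n + 1)} (hij : i ≤ j) :
    (c.hitMeanC i 0 + c.hitMeanC i (Fin.last n)) -
        (c.hitMeanC j 0 + c.hitMeanC j (Fin.last n)) =
      ∑ l : Fin (n + 1), if i ≤ l ∧ l < j then
        (1 - 2 * c.piLow l) / (c.K l (l + 1) * c.pi l) else 0 := by
  rw [hitMeanC_zero_add_hitMeanC_last, hitMeanC_zero_add_hitMeanC_last,
    sum_ite_eq_sub_of_succ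
      (F := fun m => -∑ y : Fin (n + 1), c.pi y * |c.potential m - c.potential y|) hij]
  · ring
  · intro l hl
    rw [div_eq_mul_inv, c.inv_K_mul_pi_eq l hl, ← sum_abs_potential_sub_succ]
    ring

theorem half_mul_sum_piLow_le (c : BDChain n) {lam : ℝ}
    (hlam : IsSmallestNonzeroEig (1 - c.K) lam) {M j : Fin (n + 1)} (hM : 1 / 2 ≤ c.piHigh M)
    (hj : j ≤ M) :
    1 / 2 * (∑ l : Fin (n + 1), if j ≤ l ∧ l < M then
      c.piLow j / (c.K l (l + 1) * c.pi l) else 0) ≤ 1 / lam := by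
  have hjM := Fin.le_def.1 hj
  rw [sum_ite_eq_sub_of_succ (F := fun m => c.piLow j * c.potential m) hj fun l hl => by
    rw [div_eq_mul_inv, c.inv_K_mul_pi_eq l hl, mul_sub]]
  have h := c.half_mul_mass_mul_green_le hlam (i := M) (j := j)
    (A := Finset.univ.filter (· ≤ j)) (S := Finset.univ.filter (· < M)) ?_ ?_ ?_
  · rwa [← piLow_eq, c.green_of_le_of_le hjM hjM, min_self, mul_sub] at h
  · intro x hx
    have hxj : (x : ℕ) ≤ j := by simpa using hx
    rw [c.green_of_le_of_le hjM (hxj.trans hjM), c.green_of_le_of_le hjM hjM, min_self,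
      min_eq_left (by linarith [c.potential_mono hxj])]
  · intro x hx
    have hxM : (M : ℕ) ≤ x := by simpa using hx
    exact c.green_of_le_of_ge hjM hxM
  · rw [c.sum_lt_eq]
    linarith

theorem half_mul_sum_piHigh_le (c : BDChain n) {lam : ℝ}
    (hlam : IsSmallestNonzeroEig (1 - c.K) lam) {M k : Fin (n + 1)} (hM : 1 / 2 ≤ c.piLow M)
    (hk : M ≤ k) :
    1 / 2 * (∑ l : Fin (n + 1), if M < l ∧ l ≤ k then
      c.piHigh k / (c.K l (l - 1) * c.pi l) else 0) ≤ 1 / lam := by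
  have hkM := Fin.le_def.1 hk
  rw [sum_ite_eq_sub_of_pred (F := fun m => c.piHigh k * c.potential m) hk fun l hl => by
    rw [div_eq_mul_inv, c.inv_K_sub_one_mul_pi_eq l hl, mul_sub]]
  have h := c.half_mul_mass_mul_green_le hlam (i := M) (j := k)
    (A := Finset.univ.filter (k ≤ ·)) (S := Finset.univ.filter (M < ·)) ?_ ?_ ?_
  · rwa [← piHigh_eq, c.green_of_ge_of_ge hkM hkM, min_self, mul_sub] at h
  · intro x hx
    have hxk : (k : ℕ) ≤ x := by simpa using hx
    rw [c.green_of_ge_of_ge hkM (hkM.trans hxk), c.green_of_ge_of_ge hkM hkM, min_self,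
      min_eq_left (by linarith [c.potential_mono hxk])]
  · intro x hx
    have hxM : (x : ℕ) ≤ M := by simpa using hx
    rw [c.green_comm]
    exact c.green_of_le_of_ge hxM hkM
  · rw [c.sum_gt_eq]
    linarith

end BDChain

/-- Proposition `p-hittime`.  With `s(i) = E_0 τ̃_i + E_n τ̃_i`,
`b(i)² = Var_0 τ̃_i + Var_n τ̃_i`, `λ` the spectral gap and `M` a median of `π`:
for `i ≤ j ≤ M`, `s(i) − s(j) = Σ_{ℓ=i}^{j−1} (1 − 2π([0,ℓ]))/(p_ℓ π(ℓ)) ≥ 0`, and for all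
`i`, `b(i) ≥ 1/λ ≥ (1/2) max_{j ≤ M ≤ k} max{Σ_{ℓ=j}^{M−1} π([0,j])/(p_ℓ π(ℓ)),
Σ_{ℓ=M+1}^{k} π([k,n])/(q_ℓ π(ℓ))}`. -/
theorem birth_death_hitting_time_median_bounds
    {n : ℕ} (c : BDChain n) (lam : ℝ)
    (hlam : IsSmallestNonzeroEig (1 - c.K) lam)
    (M : Fin (n + 1)) (hM1 : 1 / 2 ≤ c.piLow M) (hM2 : 1 / 2 ≤ c.piHigh M) :
    (∀ i j : Fin (n + 1), i ≤ j → j ≤ M →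
      ((c.hitMeanC i 0 + c.hitMeanC i (Fin.last n)) -
        (c.hitMeanC j 0 + c.hitMeanC j (Fin.last n)) =
        ∑ ℓ : Fin (n + 1), if i ≤ ℓ ∧ ℓ < j then
          (1 - 2 * c.piLow ℓ) / (c.K ℓ (ℓ + 1) * c.pi ℓ) else 0) ∧
      0 ≤ (c.hitMeanC i 0 + c.hitMeanC i (Fin.last n)) -
        (c.hitMeanC j 0 + c.hitMeanC j (Fin.last n))) ∧
    (∀ i : Fin (n + 1),
      1 / lam ≤ Real.sqrt (c.hitVarC i 0 + c.hitVarC i (Fin.last n))) ∧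
    (∀ j k : Fin (n + 1), j ≤ M → M ≤ k →
      (1 / 2) * max
        (∑ ℓ : Fin (n + 1), if j ≤ ℓ ∧ ℓ < M then
          c.piLow j / (c.K ℓ (ℓ + 1) * c.pi ℓ) else 0)
        (∑ ℓ : Fin (n + 1), if M < ℓ ∧ ℓ ≤ k then
          c.piHigh k / (c.K ℓ (ℓ - 1) * c.pi ℓ) else 0) ≤ 1 / lam) := by
  refine ⟨fun i j hij hj => ⟨c.hitMeanC_sub_eq hij, ?_⟩,
    fun i => c.one_div_le_sqrt_hitVarC hlam.1 hlam.2.1 i, fun j k hj hk => ?_⟩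
  · rw [c.hitMeanC_sub_eq hij]
    refine Finset.sum_nonneg fun l _ => ?_
    split_ifs with h
    · have := c.piLow_le_half hM2 (h.2.trans_le hj)
      exact div_nonneg (by linarith) (mul_nonneg (c.K_nonneg _ _) (c.pi_pos l).le)
    · rfl
  · rw [mul_max_of_nonneg _ _ (by norm_num)]
    exact max_le (c.half_mul_sum_piLow_le hlam hM2 hj) (c.half_mul_sum_piHigh_le hlam hM1 hk)

end
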